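/- Let x > 1 be a real number. Then ∑_{n=1}^{∞} L( x^n / (1 + x + x² + ⋯ + x^n)² ) = L( 1/x ), where 1 + x + ⋯ + x^n = (x^{n+1} - 1)/(x - 1). -/

import Mathlib

/-- The Rogers dilogarithm on `[0,1]`: `L(x) = Li₂(x) + (1/2)·log x · log (1-x)`
for `0 < x < 1`, with `L 0 = 0` and `L 1 = π²/6`. -/
noncomputable def rogersL (x : ℝ) : ℝ :=
  if x = 0 then 0
  else if x = 1 then Real.pi ^ 2 / 6
  else (∑' n : ℕ, x ^ (n + 1) / ((n : ℝ) + 1) ^ 2) + 1 / 2 * Real.log x * Real.log (1 - x)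

open Filter Topology Set

/-- The dilogarithm series. -/
noncomputable def dilogSeries (x : ℝ) : ℝ := ∑' n : ℕ, x ^ (n + 1) / ((n : ℝ) + 1) ^ 2

theorem rogersL_of_mem {x : ℝ} (hx : x ∈ Ioo (0 : ℝ) 1) :
    rogersL x = dilogSeries x + 1 / 2 * Real.log x * Real.log (1 - x) := by
  simp [rogersL, dilogSeries, hx.1.ne', hx.2.ne]

theorem dilogSeries_hasDerivAt {x : ℝ} (hx : x ∈ Ioo (0 : ℝ) 1) :
    HasDerivAt dilogSeries (-Real.log (1 - x) / x) x := by
  obtain ⟨r, hxr, hr1⟩ := exists_between hx.2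
  have hr0 : 0 < r := hx.1.trans hxr
  have hderiv : ∀ (n : ℕ) (y : ℝ), y ∈ Ioo (-r) r →
      HasDerivAt (fun y : ℝ => y ^ (n + 1) / ((n : ℝ) + 1) ^ 2) (y ^ n / ((n : ℝ) + 1)) y := by
    intro n y _
    have h := (hasDerivAt_pow (n + 1) y).div_const (((n : ℝ) + 1) ^ 2)
    refine h.congr_deriv ?_
    have : (n : ℝ) + 1 ≠ 0 := by positivity
    push_cast
    field_simp
  have hbound : ∀ (n : ℕ) (y : ℝ), y ∈ Ioo (-r) r → ‖y ^ n / ((n : ℝ) + 1)‖ ≤ r ^ n := by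
    intro n y hy
    have h1 : |y| ≤ r := (abs_lt.2 hy).le
    have h2 : |y| ^ n ≤ r ^ n := pow_le_pow_left₀ (abs_nonneg y) h1 n
    rw [norm_div, norm_pow, Real.norm_eq_abs, Real.norm_eq_abs,
      abs_of_pos (by positivity : (0 : ℝ) < n + 1)]
    exact (div_le_self (by positivity) (by linarith [n.cast_nonneg (α := ℝ)])).trans h2
  have h := hasDerivAt_tsum_of_isPreconnected (summable_geometric_of_lt_one hr0.le hr1)
    isOpen_Ioo isPreconnected_Ioo hderiv hbound (y₀ := 0) ⟨by linarith, hr0⟩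
    (by simp) (y := x) ⟨by linarith [hx.1], hxr⟩
  refine h.congr_deriv ?_
  have hs := Real.hasSum_pow_div_log_of_abs_lt_one (x := x) (by rw [abs_of_pos hx.1]; exact hx.2)
  rw [← (hs.div_const x).tsum_eq]
  congr 1 with n
  have := hx.1.ne'
  field_simp
  ring

theorem rogersL_hasDerivAt {x : ℝ} (hx : x ∈ Ioo (0 : ℝ) 1) :
    HasDerivAt rogersL (-(1 / 2) * (Real.log (1 - x) / x + Real.log x / (1 - x))) x := by
  have hx0 := hx.1.ne'
  have hx1 : 1 - x ≠ 0 := (sub_pos.2 hx.2).ne'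
  have h := (dilogSeries_hasDerivAt hx).add
    (((Real.hasDerivAt_log hx0).const_mul (1 / 2)).mul
      (((hasDerivAt_id x).const_sub 1).log hx1))
  have h' : HasDerivAt rogersL _ x := h.congr_of_eventuallyEq (by
    filter_upwards [isOpen_Ioo.mem_nhds hx] with y hy
    simpa using rogersL_of_mem hy)
  refine h'.congr_deriv ?_
  simp only [id]
  field_simp
  ring

theorem rogersL_comp_hasDerivAt {f : ℝ → ℝ} {f' x : ℝ} (hf : HasDerivAt f f' x)
    (hx : f x ∈ Ioo (0 : ℝ) 1) :
    HasDerivAt (fun t => rogersL (f t))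
      (-(1 / 2) * (Real.log (1 - f x) / f x + Real.log (f x) / (1 - f x)) * f') x :=
  (rogersL_hasDerivAt hx).comp x hf

theorem rogersL_nonneg {x : ℝ} (hx : x ∈ Ioo (0 : ℝ) 1) : 0 ≤ rogersL x := by
  rw [rogersL_of_mem hx]
  have h1 := Real.log_nonpos hx.1.le hx.2.le
  have h2 := Real.log_nonpos (sub_pos.2 hx.2).le (by linarith [hx.1])
  have h3 : 0 ≤ dilogSeries x := tsum_nonneg fun n => by
    have := hx.1
    positivity
  nlinarith [mul_nonneg_of_nonpos_of_nonpos h1 h2]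

theorem tendsto_dilogSeries_zero : Tendsto dilogSeries (𝓝[>] 0) (𝓝 0) := by
  have hsum : Summable fun n : ℕ => 1 / ((n : ℝ) + 1) ^ 2 := by
    have := (summable_nat_add_iff 1).2 (Real.summable_one_div_nat_pow.2 (one_lt_two))
    simpa using this
  have hc : ContinuousOn dilogSeries (Icc (-1) 1) := by
    refine continuousOn_tsum (fun n => by fun_prop) hsum fun n y hy => ?_
    rw [norm_div, norm_pow, norm_pow, Real.norm_eq_abs, Real.norm_eq_abs,
      abs_of_pos (by positivity : (0 : ℝ) < n + 1)]
    gcongr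
    exact pow_le_one₀ (abs_nonneg y) (abs_le.2 hy)
  have h := (hc.continuousAt (Icc_mem_nhds (by norm_num) (by norm_num : (0 : ℝ) < 1))).tendsto
  have h0 : dilogSeries 0 = 0 := by simp [dilogSeries]
  rw [h0] at h
  exact h.mono_left nhdsWithin_le_nhds

theorem tendsto_rogersL_zero : Tendsto rogersL (𝓝[>] 0) (𝓝 0) := by
  have hlog : Tendsto (fun x : ℝ => Real.log x * Real.log (1 - x)) (𝓝[>] 0) (𝓝 0) := by
    have hub : Tendsto (fun x : ℝ => -(x * Real.log x) / (1 - x)) (𝓝[>] 0) (𝓝 0) := by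
      have h : ContinuousAt (fun x : ℝ => -(x * Real.log x) / (1 - x)) 0 :=
        Real.continuous_mul_log.neg.continuousAt.div (by fun_prop) (by norm_num)
      have h' := h.tendsto
      simp only [zero_mul, neg_zero, zero_div] at h'
      exact h'.mono_left nhdsWithin_le_nhds
    refine squeeze_zero' ?_ ?_ hub
    · filter_upwards [Ioo_mem_nhdsGT (zero_lt_one' ℝ)] with x hx
      exact mul_nonneg_of_nonpos_of_nonpos (Real.log_nonpos hx.1.le hx.2.le)
        (Real.log_nonpos (sub_pos.2 hx.2).le (by linarith [hx.1]))
    · filter_upwards [Ioo_mem_nhdsGT (zero_lt_one' ℝ)] with x hx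
      have hx1 : 0 < 1 - x := sub_pos.2 hx.2
      have h1 := Real.log_nonpos hx.1.le hx.2.le
      have h2 := Real.one_sub_inv_le_log_of_pos hx1
      have h3 := mul_le_mul_of_nonpos_left h2 h1
      refine h3.trans_eq ?_
      field_simp
      ring
  have h := tendsto_dilogSeries_zero.add (hlog.const_mul (1 / 2))
  rw [mul_zero, add_zero] at h
  refine h.congr' ?_
  filter_upwards [Ioo_mem_nhdsGT (zero_lt_one' ℝ)] with x hx
  rw [rogersL_of_mem hx, mul_assoc]

theorem eq_of_hasDerivAt_zero_on_Ioo {f : ℝ → ℝ}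
    (hf : ∀ x ∈ Ioo (0 : ℝ) 1, HasDerivAt f 0 x) {x y : ℝ}
    (hx : x ∈ Ioo (0 : ℝ) 1) (hy : y ∈ Ioo (0 : ℝ) 1) : f x = f y :=
  isOpen_Ioo.is_const_of_deriv_eq_zero isPreconnected_Ioo
    (fun t ht => (hf t ht).differentiableAt.differentiableWithinAt)
    (fun t ht => (hf t ht).deriv) hx hy

theorem rogersL_add_rogersL_one_sub_eq {x y : ℝ} (hx : x ∈ Ioo (0 : ℝ) 1)
    (hy : y ∈ Ioo (0 : ℝ) 1) :
    rogersL x + rogersL (1 - x) = rogersL y + rogersL (1 - y) := by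
  refine eq_of_hasDerivAt_zero_on_Ioo (f := fun t => rogersL t + rogersL (1 - t))
    (fun t ht => ?_) hx hy
  have h := (rogersL_hasDerivAt ht).add (rogersL_comp_hasDerivAt
    ((hasDerivAt_id t).const_sub 1) ⟨sub_pos.2 ht.2, sub_lt_self 1 ht.1⟩)
  refine h.congr_deriv ?_
  simp only [id, sub_sub_cancel]
  ring

/-- The five-term relation of Abel for the Rogers dilogarithm. -/
theorem rogersL_five_term {x y : ℝ} (hx : x ∈ Ioo (0 : ℝ) 1) (hy : y ∈ Ioo (0 : ℝ) 1) :
    rogersL x + rogersL y = rogersL (x * y) + rogersL (x * (1 - y) / (1 - x * y)) +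
      rogersL (y * (1 - x) / (1 - x * y)) := by
  set F : ℝ → ℝ := fun t => rogersL t + rogersL y - rogersL (t * y) -
    rogersL (t * (1 - y) / (1 - t * y)) - rogersL (y * (1 - t) / (1 - t * y)) with hF
  obtain ⟨hy0, hy1⟩ := hy
  have hy1' : 0 < 1 - y := sub_pos.2 hy1
  have hderiv : ∀ t ∈ Ioo (0 : ℝ) 1, HasDerivAt F 0 t := by
    rintro t ⟨ht0, ht1⟩
    have ht1' : 0 < 1 - t := sub_pos.2 ht1
    have hD : 0 < 1 - t * y := by nlinarith
    have e3 : 1 - t * (1 - y) / (1 - t * y) = (1 - t) / (1 - t * y) := by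
      rw [one_sub_div hD.ne']; ring
    have e4 : 1 - y * (1 - t) / (1 - t * y) = (1 - y) / (1 - t * y) := by
      rw [one_sub_div hD.ne']; ring
    have hd : HasDerivAt (fun s : ℝ => 1 - s * y) (-y) t := by
      simpa using ((hasDerivAt_id t).mul_const y).const_sub 1
    have d2 : HasDerivAt (fun s : ℝ => s * y) y t := by
      simpa using (hasDerivAt_id t).mul_const y
    have d3 : HasDerivAt (fun s : ℝ => s * (1 - y) / (1 - s * y))
        ((1 - y) / (1 - t * y) ^ 2) t := by
      have := ((hasDerivAt_id t).mul_const (1 - y)).div hd hD.ne'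
      refine this.congr_deriv ?_
      simp only [id]
      congr 1
      ring
    have d4 : HasDerivAt (fun s : ℝ => y * (1 - s) / (1 - s * y))
        (-(y * (1 - y)) / (1 - t * y) ^ 2) t := by
      have := (((hasDerivAt_id t).const_sub 1).const_mul y).div hd hD.ne'
      refine this.congr_deriv ?_
      simp only [id]
      congr 1
      ring
    have m3 : t * (1 - y) / (1 - t * y) ∈ Ioo (0 : ℝ) 1 :=
      ⟨by positivity, by rw [← sub_pos, e3]; positivity⟩
    have m4 : y * (1 - t) / (1 - t * y) ∈ Ioo (0 : ℝ) 1 :=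
      ⟨by positivity, by rw [← sub_pos, e4]; positivity⟩
    have h := ((((rogersL_hasDerivAt ⟨ht0, ht1⟩).add_const (rogersL y)).sub
      (rogersL_comp_hasDerivAt d2 ⟨by positivity, sub_pos.1 hD⟩)).sub
      (rogersL_comp_hasDerivAt d3 m3)).sub (rogersL_comp_hasDerivAt d4 m4)
    refine h.congr_deriv ?_
    rw [e3, e4, Real.log_div ht1'.ne' hD.ne', Real.log_div hy1'.ne' hD.ne',
      Real.log_div (by positivity) hD.ne', Real.log_div (by positivity) hD.ne',
      Real.log_mul ht0.ne' hy0.ne', Real.log_mul ht0.ne' hy1'.ne',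
      Real.log_mul hy0.ne' ht1'.ne']
    field_simp
    ring
  have hlim : Tendsto F (𝓝[>] 0) (𝓝 0) := by
    have sub : ∀ {g : ℝ → ℝ}, ContinuousAt g 0 → g 0 = 0 → (∀ t ∈ Ioo (0 : ℝ) 1, 0 < g t) →
        Tendsto (fun t => rogersL (g t)) (𝓝[>] 0) (𝓝 0) := by
      intro g hg hg0 hpos
      refine tendsto_rogersL_zero.comp (tendsto_nhdsWithin_iff.2 ⟨?_, ?_⟩)
      · have := hg.tendsto
        rw [hg0] at this
        exact this.mono_left nhdsWithin_le_nhds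
      · filter_upwards [Ioo_mem_nhdsGT (zero_lt_one' ℝ)] with t ht using hpos t ht
    have l2 : Tendsto (fun t => rogersL (t * y)) (𝓝[>] 0) (𝓝 0) :=
      sub (by fun_prop) (by simp) fun t ht => mul_pos ht.1 hy0
    have l3 : Tendsto (fun t => rogersL (t * (1 - y) / (1 - t * y))) (𝓝[>] 0) (𝓝 0) :=
      sub (ContinuousAt.div (by fun_prop) (by fun_prop) (by simp)) (by simp) fun t ht =>
        div_pos (mul_pos ht.1 hy1') (by nlinarith [ht.1, ht.2])
    have l4 : Tendsto (fun t => rogersL (y * (1 - t) / (1 - t * y))) (𝓝[>] 0)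
        (𝓝 (rogersL y)) := by
      have hc : ContinuousAt (fun t : ℝ => y * (1 - t) / (1 - t * y)) 0 :=
        ContinuousAt.div (by fun_prop) (by fun_prop) (by simp)
      have h0 := hc.tendsto
      simp only [sub_zero, mul_one, zero_mul, div_one] at h0
      exact ((rogersL_hasDerivAt ⟨hy0, hy1⟩).continuousAt.tendsto.comp h0).mono_left
        nhdsWithin_le_nhds
    have h := (((tendsto_rogersL_zero.add_const (rogersL y)).sub l2).sub l3).sub l4
    simpa using h
  have hconst : Tendsto F (𝓝[>] 0) (𝓝 (F x)) := by
    refine tendsto_const_nhds.congr' ?_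
    filter_upwards [Ioo_mem_nhdsGT (zero_lt_one' ℝ)] with t ht
    exact eq_of_hasDerivAt_zero_on_Ioo hderiv hx ht
  have h0 : F x = 0 := tendsto_nhds_unique hconst hlim
  simp only [hF] at h0
  linarith

theorem rogersL_telescope {q : ℝ} (hq : q ∈ Ioo (0 : ℝ) 1) {n : ℕ} (hn : n ≠ 0) :
    rogersL (q ^ n * (1 - q) / (1 - q ^ (n + 1))) + rogersL ((1 - q) / (1 - q ^ (n + 1))) =
      rogersL (q ^ n * (1 - q) ^ 2 / (1 - q ^ (n + 1)) ^ 2) +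
        (rogersL (q ^ (n + 1) * (1 - q) / (1 - q ^ (n + 2))) +
          rogersL ((1 - q) / (1 - q ^ (n + 2)))) := by
  obtain ⟨hq0, hq1⟩ := hq
  have h0 : 0 < q ^ n := pow_pos hq0 n
  have h1 : 0 < 1 - q ^ n := sub_pos.2 (pow_lt_one₀ hq0.le hq1 hn)
  have h2 : 0 < 1 - q ^ (n + 1) := sub_pos.2 (pow_lt_one₀ hq0.le hq1 (by lia))
  have h3 : 0 < 1 - q ^ (n + 2) := sub_pos.2 (pow_lt_one₀ hq0.le hq1 (by lia))
  have hq1' : 0 < 1 - q := sub_pos.2 hq1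
  rw [pow_succ q (n + 1), pow_succ q n] at *
  generalize q ^ n = z at *
  have e1 : 1 - z * (1 - q) / (1 - z * q) = (1 - z) / (1 - z * q) := by
    rw [one_sub_div h2.ne']; ring
  have e2 : 1 - (1 - q) / (1 - z * q) = q * (1 - z) / (1 - z * q) := by
    rw [one_sub_div h2.ne']; ring
  have e3 : 1 - z * (1 - q) / (1 - z * q) * ((1 - q) / (1 - z * q)) =
      (1 - z) * (1 - z * q * q) / (1 - z * q) ^ 2 := by
    rw [div_mul_div_comm, one_sub_div (by positivity)]
    congr 1 <;> ring
  have h := rogersL_five_term (x := z * (1 - q) / (1 - z * q)) (y := (1 - q) / (1 - z * q))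
    ⟨by positivity, by rw [← sub_pos, e1]; positivity⟩
    ⟨by positivity, by rw [← sub_pos, e2]; positivity⟩
  rw [e1, e2, e3] at h
  rw [h, add_assoc]
  clear h e1 e2 e3
  generalize 1 - z * q * q = c at *
  generalize 1 - z * q = b at *
  generalize 1 - z = d at *
  congr 2
  · field_simp
  · congr 1
    field_simp
  · congr 1
    field_simp

theorem hasSum_rogersL {q : ℝ} (hq : q ∈ Ioo (0 : ℝ) 1) :
    HasSum (fun n : ℕ => rogersL (q ^ (n + 1) * (1 - q) ^ 2 / (1 - q ^ (n + 2)) ^ 2))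
      (rogersL q) := by
  have hq0 := hq.1
  have hq1' : 0 < 1 - q := sub_pos.2 hq.2
  have hpos : ∀ n : ℕ, 0 < 1 - q ^ (n + 1) := fun n =>
    sub_pos.2 (pow_lt_one₀ hq.1.le hq.2 (by lia))
  have hmem : ∀ n : ℕ,
      q ^ (n + 1) * (1 - q) ^ 2 / (1 - q ^ (n + 2)) ^ 2 ∈ Ioo (0 : ℝ) 1 := by
    intro n
    have a1 := hpos n
    have a2 := hpos (n + 1)
    have a3 := hpos (n + 2)
    refine ⟨by positivity, ?_⟩
    have e : 1 - q ^ (n + 1) * (1 - q) ^ 2 / (1 - q ^ (n + 2)) ^ 2 =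
        (1 - q ^ (n + 1)) * (1 - q ^ (n + 3)) / (1 - q ^ (n + 2)) ^ 2 := by
      have : 1 - q ^ (n + 2) ≠ 0 := a2.ne'
      rw [eq_div_iff (by positivity), sub_mul, div_mul_cancel₀ _ (by positivity)]
      ring
    rw [← sub_pos, e]
    positivity
  rw [hasSum_iff_tendsto_nat_of_nonneg fun n => rogersL_nonneg (hmem n)]
  set T : ℕ → ℝ := fun n => rogersL (q ^ (n + 1) * (1 - q) / (1 - q ^ (n + 2))) +
    rogersL ((1 - q) / (1 - q ^ (n + 2))) with hT
  have hpartial : ∀ N : ℕ, ∑ n ∈ Finset.range N,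
      rogersL (q ^ (n + 1) * (1 - q) ^ 2 / (1 - q ^ (n + 2)) ^ 2) = T 0 - T N := by
    intro N
    rw [← Finset.sum_range_sub']
    refine Finset.sum_congr rfl fun n _ => ?_
    have h := rogersL_telescope hq n.succ_ne_zero
    simp only [hT]
    linarith
  simp only [hpartial]
  have hT0 : T 0 = rogersL q + rogersL (1 - q) := by
    have hm : q / (1 + q) ∈ Ioo (0 : ℝ) 1 :=
      ⟨by positivity, by rw [div_lt_one (by positivity)]; linarith⟩
    rw [rogersL_add_rogersL_one_sub_eq hq hm]
    have a := (hpos 1).ne'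
    simp only [hT]
    norm_num at a ⊢
    congr 2
    · rw [div_eq_div_iff a (by positivity)]
      ring
    · rw [eq_sub_iff_add_eq, div_add_div _ _ a (by positivity), div_eq_one_iff_eq
        (mul_ne_zero a (by positivity))]
      ring
  have hpow : ∀ k : ℕ, Tendsto (fun n : ℕ => q ^ (n + k)) atTop (𝓝 0) := fun k =>
    (tendsto_add_atTop_iff_nat k).2 (tendsto_pow_atTop_nhds_zero_of_lt_one hq.1.le hq.2)
  have hden : Tendsto (fun n : ℕ => 1 - q ^ (n + 2)) atTop (𝓝 1) := by
    simpa using (hpow 2).const_sub 1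
  have hTlim : Tendsto T atTop (𝓝 (0 + rogersL (1 - q))) := by
    refine Tendsto.add (tendsto_rogersL_zero.comp (tendsto_nhdsWithin_iff.2 ⟨?_, ?_⟩)) ?_
    · simpa [Pi.div_def] using ((hpow 1).mul_const (1 - q)).div hden one_ne_zero
    · refine Eventually.of_forall fun n => ?_
      have := hpos (n + 1)
      exact div_pos (by positivity) this
    · have hl : Tendsto (fun n : ℕ => (1 - q) / (1 - q ^ (n + 2))) atTop (𝓝 (1 - q)) := by
        simpa [Pi.div_def] using (tendsto_const_nhds (x := 1 - q)).div hden one_ne_zero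
      exact (rogersL_hasDerivAt ⟨hq1', sub_lt_self 1 hq.1⟩).continuousAt.tendsto.comp hl
  have h := hTlim.const_sub (T 0)
  rw [hT0] at h ⊢
  simpa using h

theorem stmt_15 (x : ℝ) (hx : 1 < x) :
    ∑' n : ℕ, rogersL (x ^ (n + 1) / (∑ i ∈ Finset.range (n + 2), x ^ i) ^ 2) =
      rogersL (1 / x) := by
  have hx0 : 0 < x := one_pos.trans hx
  have h := (hasSum_rogersL (q := 1 / x) ⟨by positivity, by rwa [div_lt_one hx0]⟩).tsum_eq
  rw [← h]
  congr 1 with n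
  have a1 : x - 1 ≠ 0 := (sub_pos.2 hx).ne'
  have a2 : x ^ (n + 2) - 1 ≠ 0 := (sub_pos.2 (one_lt_pow₀ hx (by lia))).ne'
  have e1 : 1 - 1 / x = (x - 1) / x := by field_simp
  have e2 : 1 - (1 / x) ^ (n + 2) = (x ^ (n + 2) - 1) / x ^ (n + 2) := by
    rw [one_div, inv_pow]
    field_simp
  rw [geom_sum_eq hx.ne', e1, e2, one_div, inv_pow]
  congr 1
  field_simp
  ring
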